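/- Let f = χ_B with B a ball contained in [0,1]^d, d = 2 or 3, and let Φ be the Haar tensor wavelet basis of L²([0,1]^d). Then the best N-term wavelet approximation f_N satisfies ‖f − f_N‖²_{L²} ≍ N^{-1/(d-1)} as N → ∞. -/

import Mathlib

open MeasureTheory

/-- The 1D Haar wavelet. -/
noncomputable def haarH : ℝ → ℝ :=
  (Set.Ico (0 : ℝ) (1 / 2)).indicator 1 - (Set.Ico (1 / 2 : ℝ) 1).indicator 1

/-- The 1D Haar scaling function. -/
noncomputable def haarP : ℝ → ℝ := (Set.Ico (0 : ℝ) 1).indicator 1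

/-- Coefficients of `χ_B` against the Haar tensor wavelet system: `none` is the scaling
function at scale `0`, and `some (g, j, k)` is the tensor wavelet of type `g` at scale `j`
and translation `k`. -/
noncomputable def haarTensorCoeff (d : ℕ) (B : Set (Fin d → ℝ)) :
    Option ({g : Fin d → Bool // g ≠ fun _ => false} × ℕ × (Fin d → ℤ)) → ℝ
  | none => (volume B).toReal
  | some (g, j, k) =>
      ∫ x in B, (2 : ℝ) ^ ((j : ℝ) * d / 2) *
        ∏ i, (if g.1 i then haarH else haarP) ((2 : ℝ) ^ (j : ℕ) * x i - (k i : ℝ))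

/-- Rate of best `N`-term approximation for a nonnegative family whose size-`2⁻ʲ⁽ᵉ⁺¹⁾` entries
number about `2ʲᵉ`. -/
theorem exists_rate_of_sparse_levels {ι : Type*} [Infinite ι] (a : ι → ℝ) (ha : ∀ i, 0 ≤ a i)
    (e : ℕ) (he : e ≠ 0) {C c : ℝ} (hC : 0 < C) (hc : 0 < c) (U : ℕ → Finset ι)
    (hU : ∀ J, ((U J).card : ℝ) ≤ C * (2 ^ J) ^ e)
    (htail : ∀ J (u : Finset ι), Disjoint u (U J) → ∑ i ∈ u, a i ≤ C / 2 ^ J)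
    (j₀ : ℕ) (hA : ∀ j, j₀ ≤ j → ∃ A : Finset ι, c * (2 ^ j) ^ e ≤ A.card ∧
      ∀ i ∈ A, c / (2 ^ j) ^ (e + 1) ≤ a i)
    (bestErr : ℕ → ℝ)
    (hbest : ∀ N : ℕ, bestErr N = sInf {t : ℝ | ∃ S : Finset ι,
      S.card = N ∧ t = ∑' i : {i // i ∉ S}, a i.1}) :
    ∃ c C : ℝ, 0 < c ∧ 0 < C ∧ ∃ N₀ : ℕ, ∀ N : ℕ, N₀ ≤ N →
      c * (N : ℝ) ^ (-(1 : ℝ) / (e : ℝ)) ≤ bestErr N ∧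
      bestErr N ≤ C * (N : ℝ) ^ (-(1 : ℝ) / (e : ℝ)) := by
  classical
  have hsum : Summable a := by
    refine summable_of_sum_le (c := ∑ i ∈ U 0, a i + C) ha fun u => ?_
    have h1 := Finset.sum_inter_add_sum_sdiff u (U 0) a
    have h2 := htail 0 (u \ U 0) Finset.sdiff_disjoint
    have h3 : ∑ i ∈ u ∩ U 0, a i ≤ ∑ i ∈ U 0, a i :=
      Finset.sum_le_sum_of_subset_of_nonneg Finset.inter_subset_right fun i _ _ => ha i
    simp only [pow_zero, div_one] at h2
    linarith
  set β : ℝ := max 1 (2 / c) with hβ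
  set γ : ℝ := max 1 C with hγ
  have hβ1 : 1 ≤ β := le_max_left _ _
  have hβc : 2 ≤ c * β := by
    have : 2 / c ≤ β := le_max_right _ _
    rw [div_le_iff₀ hc] at this; linarith
  have hγ1 : 1 ≤ γ := le_max_left _ _
  have hγC : C ≤ γ := le_max_right _ _
  have hγ0 : 0 < γ := by linarith
  have hβ0 : 0 < β := by linarith
  obtain ⟨N₁, hN₁⟩ := exists_nat_ge (γ ^ e)
  refine ⟨c ^ 2 * β⁻¹ / 4, 2 * C * γ, by positivity, by positivity,
    max 1 (max N₁ ((2 ^ j₀) ^ e)), fun N hN => ?_⟩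
  have hN1 : 1 ≤ N := le_trans (le_max_left _ _) hN
  have hN0 : (0 : ℝ) < N := by exact_mod_cast hN1
  have hNγ : γ ^ e ≤ (N : ℝ) := hN₁.trans (by
    exact_mod_cast (le_trans (le_max_left _ _) (le_max_right _ _)).trans hN)
  have hNj : ((2 : ℝ) ^ j₀) ^ e ≤ (N : ℝ) := by
    exact_mod_cast (le_trans (le_max_right _ _) (le_max_right _ _)).trans hN
  obtain ⟨t, ht0, hte, htN⟩ : ∃ t : ℝ, 0 < t ∧ t ^ e = N ∧
      (N : ℝ) ^ (-(1 : ℝ) / (e : ℝ)) = t⁻¹ := by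
    refine ⟨(N : ℝ) ^ ((1 : ℝ) / e), by positivity, ?_, ?_⟩
    · rw [← Real.rpow_natCast, ← Real.rpow_mul hN0.le]
      have : (e : ℝ) ≠ 0 := by exact_mod_cast he
      rw [one_div_mul_cancel this, Real.rpow_one]
    · rw [neg_div, Real.rpow_neg hN0.le]
  rw [htN]
  have hbdd : BddBelow {t : ℝ | ∃ S : Finset ι,
      S.card = N ∧ t = ∑' i : {i // i ∉ S}, a i.1} := by
    refine ⟨0, ?_⟩
    rintro _ ⟨S, -, rfl⟩
    exact tsum_nonneg fun i => ha _
  have hγt : γ ≤ t := by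
    rw [← hte] at hNγ
    exact le_of_pow_le_pow_left₀ he ht0.le hNγ
  have hjt : (2 : ℝ) ^ j₀ ≤ t := by
    rw [← hte] at hNj
    exact le_of_pow_le_pow_left₀ he ht0.le hNj
  rw [hbest N]
  constructor
  · refine le_csInf ?_ ?_
    · obtain ⟨S, hS⟩ := Infinite.exists_subset_card_eq ι N
      exact ⟨_, S, hS, rfl⟩
    rintro _ ⟨S, hS, rfl⟩
    obtain ⟨J, hJ1, hJ2⟩ := exists_nat_pow_near (x := β * t) (y := 2)
      (by nlinarith [hγ1.trans hγt]) one_lt_two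
    have hj : j₀ ≤ J + 1 := by
      by_contra hlt
      have : (2 : ℝ) ^ (J + 1) ≤ 2 ^ j₀ := pow_le_pow_right₀ one_le_two (by omega)
      nlinarith
    obtain ⟨A, hAc, hAa⟩ := hA (J + 1) hj
    have hcard : 2 * (N : ℝ) ≤ c * (2 ^ (J + 1)) ^ e := by
      calc 2 * (N : ℝ) ≤ c * β * N := by nlinarith
        _ ≤ c * β ^ e * N := by
          have := le_self_pow₀ hβ1 he
          gcongr
        _ = c * (β * t) ^ e := by rw [mul_pow, hte]; ring
        _ ≤ c * (2 ^ (J + 1)) ^ e := by gcongr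
    have hsd : c * (2 ^ (J + 1)) ^ e / 2 ≤ ((A \ S).card : ℝ) := by
      have : A.card ≤ (A \ S).card + S.card := by
        have := Finset.le_card_sdiff S A
        omega
      have h' : (A.card : ℝ) ≤ (A \ S).card + N := by
        rw [← hS]; exact_mod_cast this
      linarith
    have hle : ∑ i ∈ A \ S, a i ≤ ∑' i : {i // i ∉ S}, a i.1 := by
      have hs : Summable fun i : {i // i ∉ S} => a i.1 := hsum.subtype _
      have := hs.sum_le_tsum ((A \ S).subtype fun i => i ∉ S) fun i _ => ha _
      rwa [Finset.sum_subtype_of_mem a (fun i hi => (Finset.mem_sdiff.1 hi).2)] at this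
    refine le_trans ?_ hle
    have h3 : ((A \ S).card : ℝ) * (c / (2 ^ (J + 1)) ^ (e + 1)) ≤ ∑ i ∈ A \ S, a i := by
      rw [← nsmul_eq_mul]
      exact Finset.card_nsmul_le_sum _ _ _ fun i hi => hAa i (Finset.mem_sdiff.1 hi).1
    refine le_trans ?_ h3
    calc c ^ 2 * β⁻¹ / 4 * t⁻¹ = c ^ 2 / 2 * (2 * (β * t))⁻¹ := by
          field_simp; norm_num
      _ ≤ c ^ 2 / 2 * (2 ^ (J + 1))⁻¹ := by
          gcongr
          rw [pow_succ]; linarith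
      _ = c * (2 ^ (J + 1)) ^ e / 2 * (c / (2 ^ (J + 1)) ^ (e + 1)) := by
          field_simp; ring
      _ ≤ _ := by gcongr
  · obtain ⟨J, hJ1, hJ2⟩ := exists_nat_pow_near (x := t / γ) (y := 2)
      (by rwa [le_div_iff₀ hγ0, one_mul]) one_lt_two
    have hcard : (U J).card ≤ N := by
      have : ((U J).card : ℝ) ≤ N := by
        calc ((U J).card : ℝ) ≤ C * (2 ^ J) ^ e := hU J
          _ ≤ γ * (t / γ) ^ e := by gcongr
          _ ≤ γ ^ e * (t / γ) ^ e := by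
            have := le_self_pow₀ hγ1 he
            gcongr
          _ = N := by rw [← mul_pow, mul_div_cancel₀ _ hγ0.ne', hte]
      exact_mod_cast this
    obtain ⟨S, hUS, hS⟩ := Infinite.exists_superset_card_eq (U J) N hcard
    refine (csInf_le hbdd ⟨S, hS, rfl⟩).trans ?_
    have : ∑' i : {i // i ∉ S}, a i.1 ≤ C / 2 ^ J := by
      refine Real.tsum_le_of_sum_le (fun i => ha _) fun u => ?_
      have := htail J (u.map (Function.Embedding.subtype _)) (by
        rw [Finset.disjoint_left]
        intro i hi hi'
        obtain ⟨i, -, rfl⟩ := Finset.mem_map.1 hi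
        exact i.2 (hUS hi'))
      simpa using this
    refine this.trans ?_
    have h2 : t / (2 * γ) ≤ 2 ^ J := by
      rw [pow_succ, div_lt_iff₀ hγ0] at hJ2
      rw [div_le_iff₀ (by positivity)]
      linarith
    calc C / 2 ^ J ≤ C / (t / (2 * γ)) := by gcongr
      _ = 2 * C * γ * t⁻¹ := by field_simp

theorem haarP_apply (t : ℝ) : haarP t = if 0 ≤ t ∧ t < 1 then 1 else 0 := by
  simp [haarP, Set.indicator_apply]

theorem haarH_apply (t : ℝ) :
    haarH t = (if 0 ≤ t ∧ t < 1 / 2 then 1 else 0) - if 1 / 2 ≤ t ∧ t < 1 then 1 else 0 := by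
  simp [haarH, Set.indicator_apply]

theorem integral_haarH : ∫ t, haarH t = 0 := by
  have h : ∀ a b : ℝ, Integrable ((Set.Ico a b).indicator (1 : ℝ → ℝ)) := fun a b =>
    (integrable_indicator_iff measurableSet_Ico).2 (integrableOn_const (by simp))
  rw [haarH, integral_sub' (h _ _) (h _ _), integral_indicator_one measurableSet_Ico,
    integral_indicator_one measurableSet_Ico]
  norm_num

section

variable {d : ℕ}

/-- The unnormalised tensor wavelet of type `g` on the dyadic cell `k` of scale `j`. -/
noncomputable def tensorWavelet (g : Fin d → Bool) (j : ℕ) (k : Fin d → ℤ) (x : Fin d → ℝ) : ℝ :=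
  ∏ i, (if g i then haarH else haarP) ((2 : ℝ) ^ j * x i - (k i : ℝ))

/-- The half-open dyadic cube with lower corner `k / 2 ^ j` and side `1 / 2 ^ j`. -/
def dyadicCell (j : ℕ) (k : Fin d → ℤ) : Set (Fin d → ℝ) :=
  Set.univ.pi fun i => Set.Ico ((k i : ℝ) / 2 ^ j) ((k i + 1 : ℝ) / 2 ^ j)

theorem mem_dyadicCell {j : ℕ} {k : Fin d → ℤ} {x : Fin d → ℝ} :
    x ∈ dyadicCell j k ↔ ∀ i, (k i : ℝ) ≤ 2 ^ j * x i ∧ 2 ^ j * x i < k i + 1 := by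
  have h : (0 : ℝ) < 2 ^ j := by positivity
  simp only [dyadicCell, Set.mem_univ_pi, Set.mem_Ico, div_le_iff₀ h, lt_div_iff₀ h,
    mul_comm (2 ^ j : ℝ)]

theorem measurableSet_dyadicCell (j : ℕ) (k : Fin d → ℤ) : MeasurableSet (dyadicCell j k) :=
  MeasurableSet.univ_pi fun _ => measurableSet_Ico

theorem volume_dyadicCell (j : ℕ) (k : Fin d → ℤ) :
    volume (dyadicCell j k) = ENNReal.ofReal (((2 : ℝ) ^ j)⁻¹ ^ d) := by
  rw [dyadicCell, Real.volume_pi_Ico, ENNReal.ofReal_pow (by positivity)]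
  simp [← sub_div]

theorem disjoint_dyadicCell {j : ℕ} {k l : Fin d → ℤ} (h : k ≠ l) :
    Disjoint (dyadicCell j k) (dyadicCell j l) := by
  rw [Set.disjoint_left]
  refine fun x hk hl => h (funext fun i => ?_)
  rw [mem_dyadicCell] at hk hl
  rw [← Int.floor_eq_iff.2 (hk i), ← Int.floor_eq_iff.2 (hl i)]

theorem tensorWavelet_eq_zero {g : Fin d → Bool} {j : ℕ} {k : Fin d → ℤ} {x : Fin d → ℝ}
    (hx : x ∉ dyadicCell j k) : tensorWavelet g j k x = 0 := by
  rw [mem_dyadicCell] at hx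
  push Not at hx
  obtain ⟨i, hi⟩ := hx
  refine Finset.prod_eq_zero (Finset.mem_univ i) ?_
  split_ifs
  · rw [haarH_apply, if_neg, if_neg, sub_zero]
    · rintro ⟨h1, h2⟩; linarith [hi (by linarith)]
    · rintro ⟨h1, h2⟩; linarith [hi (by linarith)]
  · rw [haarP_apply, if_neg]
    rintro ⟨h1, h2⟩; linarith [hi (by linarith)]

theorem abs_tensorWavelet_le (g : Fin d → Bool) (j : ℕ) (k : Fin d → ℤ) (x : Fin d → ℝ) :
    |tensorWavelet g j k x| ≤ 1 := by
  rw [tensorWavelet, Finset.abs_prod]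
  refine Finset.prod_le_one (fun _ _ => abs_nonneg _) fun i _ => ?_
  split_ifs
  · rw [haarH_apply]
    split_ifs with h1 h2
    · linarith [h1.2, h2.1]
    all_goals norm_num
  · rw [haarP_apply]
    split_ifs <;> norm_num

theorem integral_tensorWavelet {g : Fin d → Bool} (hg : g ≠ fun _ => false) (j : ℕ)
    (k : Fin d → ℤ) : ∫ x, tensorWavelet g j k x = 0 := by
  obtain ⟨i, hi⟩ : ∃ i, g i = true := by
    by_contra! h
    exact hg (funext fun i => by simpa using h i)
  unfold tensorWavelet
  rw [integral_fintype_prod_volume_eq_prod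
    (fun i (t : ℝ) => (if g i then haarH else haarP) ((2 : ℝ) ^ j * t - (k i : ℝ)))]
  refine Finset.prod_eq_zero (Finset.mem_univ i) ?_
  simp only [hi, if_true]
  rw [Measure.integral_comp_mul_left (fun t => haarH (t - k i)),
    integral_sub_right_eq_self haarH, integral_haarH, smul_zero]

theorem setIntegral_tensorWavelet_inter (B : Set (Fin d → ℝ)) (g : Fin d → Bool) (j : ℕ)
    (k : Fin d → ℤ) :
    ∫ x in B, tensorWavelet g j k x = ∫ x in B ∩ dyadicCell j k, tensorWavelet g j k x := by
  rw [← setIntegral_indicator (measurableSet_dyadicCell j k)]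
  congr 1
  ext x
  by_cases hx : x ∈ dyadicCell j k
  · rw [Set.indicator_of_mem hx]
  · rw [Set.indicator_of_notMem hx, tensorWavelet_eq_zero hx]

theorem abs_setIntegral_tensorWavelet_le (B : Set (Fin d → ℝ)) (g : Fin d → Bool) (j : ℕ)
    (k : Fin d → ℤ) : |∫ x in B, tensorWavelet g j k x| ≤ ((2 : ℝ) ^ j)⁻¹ ^ d := by
  rw [setIntegral_tensorWavelet_inter]
  have hv : volume (B ∩ dyadicCell j k) ≤ ENNReal.ofReal (((2 : ℝ) ^ j)⁻¹ ^ d) :=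
    (measure_mono Set.inter_subset_right).trans (volume_dyadicCell j k).le
  have := norm_setIntegral_le_of_norm_le_const (f := tensorWavelet g j k) (C := 1)
    (hv.trans_lt ENNReal.ofReal_lt_top) fun x _ => abs_tensorWavelet_le g j k x
  rw [one_mul] at this
  exact this.trans (ENNReal.toReal_le_of_le_ofReal (by positivity) hv)

theorem setIntegral_tensorWavelet_eq_zero {B : Set (Fin d → ℝ)} {g : Fin d → Bool}
    (hg : g ≠ fun _ => false) {j : ℕ} {k : Fin d → ℤ}
    (h : dyadicCell j k ⊆ B ∨ ¬ (dyadicCell j k ∩ B).Nonempty) :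
    ∫ x in B, tensorWavelet g j k x = 0 := by
  rcases h with h | h
  · rw [setIntegral_eq_integral_of_forall_compl_eq_zero, integral_tensorWavelet hg]
    exact fun x hx => tensorWavelet_eq_zero fun hx' => hx (h hx')
  · rw [setIntegral_tensorWavelet_inter, Set.inter_comm, Set.not_nonempty_iff_eq_empty.1 h]
    simp

theorem haarTensorCoeff_some (B : Set (Fin d → ℝ)) (g : {g : Fin d → Bool // g ≠ fun _ => false})
    (j : ℕ) (k : Fin d → ℤ) :
    haarTensorCoeff d B (some (g, j, k)) =
      (2 : ℝ) ^ ((j : ℝ) * d / 2) * ∫ x in B, tensorWavelet g.1 j k x := by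
  rw [← integral_const_mul]; rfl

theorem haarTensorCoeff_sq (B : Set (Fin d → ℝ)) (g : {g : Fin d → Bool // g ≠ fun _ => false})
    (j : ℕ) (k : Fin d → ℤ) :
    haarTensorCoeff d B (some (g, j, k)) ^ 2 =
      ((2 : ℝ) ^ j) ^ d * (∫ x in B, tensorWavelet g.1 j k x) ^ 2 := by
  rw [haarTensorCoeff_some, mul_pow]
  congr 1
  rw [← Real.rpow_natCast, ← Real.rpow_mul zero_le_two, ← pow_mul, ← Real.rpow_natCast]
  congr 1
  push_cast
  ring

/-- The open Euclidean ball in `Fin d → ℝ`. -/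
def euclBall (x₀ : Fin d → ℝ) (r : ℝ) : Set (Fin d → ℝ) := {x | ∑ i, (x i - x₀ i) ^ 2 < r ^ 2}

theorem isOpen_euclBall (x₀ : Fin d → ℝ) (r : ℝ) : IsOpen (euclBall x₀ r) :=
  isOpen_lt (by fun_prop) continuous_const

theorem center_mem_euclBall (x₀ : Fin d → ℝ) {r : ℝ} (hr : 0 < r) : x₀ ∈ euclBall x₀ r := by
  simp [euclBall, hr]

open scoped Pointwise in
theorem volume_euclBall (x₀ : Fin d → ℝ) {r : ℝ} (hr : 0 < r) :
    volume (euclBall x₀ r) = ENNReal.ofReal (r ^ d) * volume (euclBall (0 : Fin d → ℝ) 1) := by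
  have h : euclBall x₀ r =
      (fun x => x + -x₀) ⁻¹' (r • euclBall (0 : Fin d → ℝ) 1) := by
    ext x
    have : ∑ i, (r⁻¹ * (x i + -x₀ i)) ^ 2 = (∑ i, (x i - x₀ i) ^ 2) / r ^ 2 := by
      rw [Finset.sum_div]
      exact Finset.sum_congr rfl fun i _ => by field_simp; ring
    simp only [Set.mem_preimage, Set.mem_smul_set_iff_inv_smul_mem₀ hr.ne', euclBall,
      Set.mem_ofPred_eq, Pi.smul_apply, Pi.add_apply, Pi.neg_apply, Pi.zero_apply, sub_zero,
      smul_eq_mul, this, one_pow]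
    rw [div_lt_one (by positivity)]
  rw [h, measure_preimage_add_right, Measure.addHaar_smul, Module.finrank_fin_fun,
    abs_of_pos (by positivity)]

theorem volume_euclBall_lt_top (x₀ : Fin d → ℝ) (r : ℝ) : volume (euclBall x₀ r) < ⊤ := by
  refine (measure_mono (t := Metric.closedBall x₀ |r|) fun x hx => ?_).trans_lt
    measure_closedBall_lt_top
  rw [Metric.mem_closedBall, dist_pi_le_iff (abs_nonneg r)]
  intro i
  rw [Real.dist_eq]
  refine sq_le_sq.1 (le_trans ?_ (le_of_lt hx))
  exact Finset.single_le_sum (f := fun i => (x i - x₀ i) ^ 2) (fun i _ => sq_nonneg _)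
    (Finset.mem_univ i)

theorem volumeReal_euclBall (x₀ : Fin d → ℝ) {r : ℝ} (hr : 0 < r) :
    volume.real (euclBall x₀ r) = r ^ d * volume.real (euclBall (0 : Fin d → ℝ) 1) := by
  rw [measureReal_def, volume_euclBall x₀ hr, ENNReal.toReal_mul,
    ENNReal.toReal_ofReal (by positivity), measureReal_def]

theorem abs_sub_le_of_mem_dyadicCell {j : ℕ} {k : Fin d → ℤ} {x y : Fin d → ℝ}
    (hx : x ∈ dyadicCell j k) (hy : y ∈ dyadicCell j k) (i : Fin d) :
    |x i - y i| ≤ ((2 : ℝ) ^ j)⁻¹ := by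
  have h : (0 : ℝ) < 2 ^ j := by positivity
  rw [mem_dyadicCell] at hx hy
  have h1 := hx i
  have h2 := hy i
  rw [abs_sub_le_iff, ← one_div, le_div_iff₀ h, le_div_iff₀ h]
  constructor <;> linarith

/-- The cells of scale `j` that meet `B` without being contained in it. -/
def boundaryCells (B : Set (Fin d → ℝ)) (j : ℕ) : Set (Fin d → ℤ) :=
  {k | ¬ dyadicCell j k ⊆ B ∧ (dyadicCell j k ∩ B).Nonempty}

theorem boundaryCells_finite {B : Set (Fin d → ℝ)}
    (hB : B ⊆ Set.univ.pi fun _ => Set.Icc (0 : ℝ) 1) (j : ℕ) : (boundaryCells B j).Finite := by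
  refine (Set.Finite.pi' (t := fun _ => Set.Icc (0 : ℤ) (2 ^ j))
    fun _ => Set.finite_Icc _ _).subset ?_
  rintro k ⟨-, x, hx, hxB⟩ i
  have h : (0 : ℝ) < 2 ^ j := by positivity
  have h1 := mem_dyadicCell.1 hx i
  have h2 := hB hxB i (Set.mem_univ i)
  constructor
  · have : (-1 : ℝ) < k i := by nlinarith [h2.1]
    have : -1 < k i := by exact_mod_cast this
    omega
  · have : (k i : ℝ) ≤ 2 ^ j := by nlinarith [h2.2]
    exact_mod_cast this

theorem exists_card_boundaryCells_le {r : ℝ} (hr : 0 < r) (x₀ : Fin d → ℝ)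
    (hB : euclBall x₀ r ⊆ Set.univ.pi fun _ => Set.Icc (0 : ℝ) 1) :
    ∃ C : ℝ, 0 ≤ C ∧ ∀ (j : ℕ) (F : Finset (Fin d → ℤ)),
      (F : Set (Fin d → ℤ)) ⊆ boundaryCells (euclBall x₀ r) j →
      F.card * ((2 : ℝ) ^ j)⁻¹ ^ d ≤ C * ((2 : ℝ) ^ j)⁻¹ := by
  set V := volume.real (euclBall (0 : Fin d → ℝ) 1)
  refine ⟨V * (2 * (4 * d / r) * d * (2 * r) ^ (d - 1)) + 3 ^ d * (4 * d / r ^ 2),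
    by positivity, fun j F hF => ?_⟩
  set s : ℝ := ((2 : ℝ) ^ j)⁻¹ with hs
  have hs0 : 0 < s := by positivity
  have hs1 : s ≤ 1 := inv_le_one_of_one_le₀ (one_le_pow₀ one_le_two)
  have hx₀ := hB (center_mem_euclBall x₀ hr)
  set W : Set (Fin d → ℝ) := ⋃ k ∈ F, dyadicCell j k with hW
  have hvol : volume.real W = F.card * s ^ d := by
    have hcell : ∀ k : Fin d → ℤ, volume.real (dyadicCell j k) = s ^ d := fun k => by
      rw [measureReal_def, volume_dyadicCell, ENNReal.toReal_ofReal (by positivity)]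
    rw [hW, measureReal_biUnion_finset (fun k _ l _ h => disjoint_dyadicCell h)
      (fun k _ => measurableSet_dyadicCell j k)
      (fun k _ => by rw [volume_dyadicCell]; exact ENNReal.ofReal_ne_top)]
    simp [hcell]
  rw [← hvol]
  have hcube : W ⊆ Set.univ.pi fun _ => Set.Icc (-1 : ℝ) 2 := by
    intro x hx i _
    obtain ⟨k, hk, hxk⟩ := Set.mem_iUnion₂.1 hx
    obtain ⟨-, y, hy, hyB⟩ := hF hk
    have h1 := abs_le.1 (abs_sub_le_of_mem_dyadicCell hxk hy i)
    have h2 := hB hyB i (Set.mem_univ i)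
    constructor <;> linarith [h1.1, h1.2, h2.1, h2.2]
  have hdiff : ∀ k ∈ F, ∀ x ∈ dyadicCell j k, ∀ y ∈ dyadicCell j k,
      ∑ i, (x i - x₀ i) ^ 2 ≤ ∑ i, (y i - x₀ i) ^ 2 + 4 * d * s := by
    intro k hk x hx y hy
    have : ∀ i, (x i - x₀ i) ^ 2 ≤ (y i - x₀ i) ^ 2 + 4 * s := by
      intro i
      have h1 := abs_sub_le_of_mem_dyadicCell hx hy i
      have h2 := hcube (Set.mem_iUnion₂.2 ⟨k, hk, hx⟩) i (Set.mem_univ i)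
      have h3 := hcube (Set.mem_iUnion₂.2 ⟨k, hk, hy⟩) i (Set.mem_univ i)
      have h4 := hx₀ i (Set.mem_univ i)
      have h5 : |x i + y i - 2 * x₀ i| ≤ 4 := by
        rw [abs_le]; constructor <;> linarith [h2.1, h2.2, h3.1, h3.2, h4.1, h4.2]
      have h6 : (x i - y i) * (x i + y i - 2 * x₀ i) ≤ s * 4 := by
        refine (le_abs_self _).trans ?_
        rw [abs_mul]
        exact mul_le_mul h1 h5 (abs_nonneg _) hs0.le
      nlinarith
    refine (Finset.sum_le_sum fun i _ => this i).trans ?_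
    rw [Finset.sum_add_distrib]
    simp only [Finset.sum_const, Finset.card_univ, Fintype.card_fin, nsmul_eq_mul]
    linarith
  set ε : ℝ := 4 * d * s / r with hε
  have hε0 : 0 ≤ ε := by positivity
  have hεr : ε * r = 4 * d * s := by rw [hε]; field_simp
  by_cases hlt : ε < r
  · have hshell : W ⊆ euclBall x₀ (r + ε) \ euclBall x₀ (r - ε) := by
      intro x hx
      obtain ⟨k, hk, hxk⟩ := Set.mem_iUnion₂.1 hx
      obtain ⟨hns, y, hy, hyB⟩ := hF hk
      obtain ⟨z, hz, hzB⟩ := Set.not_subset.1 hns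
      have h1 := hdiff k hk x hxk y hy
      have h2 := hdiff k hk z hz x hxk
      simp only [euclBall, Set.mem_ofPred_eq, not_lt, Set.mem_sdiff] at hyB hzB ⊢
      constructor <;> nlinarith
    have hsub : euclBall x₀ (r - ε) ⊆ euclBall x₀ (r + ε) := by
      intro x hx
      simp only [euclBall, Set.mem_ofPred_eq] at hx ⊢
      nlinarith
    have h1 : volume.real W ≤ volume.real (euclBall x₀ (r + ε) \ euclBall x₀ (r - ε)) :=
      measureReal_mono hshell
        ((measure_mono Set.sdiff_subset).trans_lt (volume_euclBall_lt_top _ _)).ne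
    rw [measureReal_sdiff hsub (isOpen_euclBall _ _).measurableSet
      (volume_euclBall_lt_top _ _).ne, volumeReal_euclBall x₀ (by linarith),
      volumeReal_euclBall x₀ (by linarith)] at h1
    have h2 : (r + ε) ^ d - (r - ε) ^ d ≤ 2 * ε * d * (2 * r) ^ (d - 1) := by
      refine (le_abs_self _).trans ((abs_pow_sub_pow_le _ _ _).trans ?_)
      have e1 : |r + ε - (r - ε)| = 2 * ε := by
        rw [show r + ε - (r - ε) = 2 * ε by ring, abs_of_nonneg (by linarith)]
      have e2 : max |r + ε| |r - ε| ≤ 2 * r := by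
        rw [abs_of_pos (by linarith), abs_of_pos (by linarith)]
        exact max_le (by linarith) (by linarith)
      rw [e1]
      gcongr
    have hV : 0 ≤ V := measureReal_nonneg
    calc volume.real W ≤ V * ((r + ε) ^ d - (r - ε) ^ d) := by linarith
      _ ≤ V * (2 * ε * d * (2 * r) ^ (d - 1)) := by gcongr
      _ = V * (2 * (4 * d / r) * d * (2 * r) ^ (d - 1)) * s := by rw [hε]; ring
      _ ≤ _ := by
        gcongr
        exact le_add_of_nonneg_right (by positivity)
  · have h1 : volume.real W ≤ volume.real (Set.univ.pi fun _ : Fin d => Set.Icc (-1 : ℝ) 2) :=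
      measureReal_mono hcube (by rw [volume_pi_pi]; simp)
    have h2 : volume.real (Set.univ.pi fun _ : Fin d => Set.Icc (-1 : ℝ) 2) = 3 ^ d := by
      rw [measureReal_def, volume_pi_pi]
      norm_num
    have h3 : 1 ≤ 4 * d / r ^ 2 * s := by
      rw [div_mul_eq_mul_div, le_div_iff₀ (by positivity)]
      nlinarith
    have hV : 0 ≤ V := measureReal_nonneg
    calc volume.real W ≤ 3 ^ d * 1 := by linarith
      _ ≤ 3 ^ d * (4 * d / r ^ 2 * s) := by gcongr
      _ = 3 ^ d * (4 * d / r ^ 2) * s := by ring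
      _ ≤ _ := by
        gcongr
        exact le_add_of_nonneg_left (by positivity)

/-- The wavelet type oscillating in the coordinate `i₀` only. -/
def singleType (i₀ : Fin d) : {g : Fin d → Bool // g ≠ fun _ => false} :=
  ⟨fun i => decide (i = i₀), fun h => by simpa using congrFun h i₀⟩

/-- The half of a dyadic cell with smaller coordinate `i₀`. -/
def lowerHalf (i₀ : Fin d) (j : ℕ) (k : Fin d → ℤ) : Set (Fin d → ℝ) :=
  dyadicCell j k ∩ {x | 2 ^ j * x i₀ - k i₀ < 1 / 2}

/-- The half of a dyadic cell with larger coordinate `i₀`. -/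
def upperHalf (i₀ : Fin d) (j : ℕ) (k : Fin d → ℤ) : Set (Fin d → ℝ) :=
  dyadicCell j k ∩ {x | 1 / 2 ≤ 2 ^ j * x i₀ - k i₀}

theorem measurableSet_lowerHalf (i₀ : Fin d) (j : ℕ) (k : Fin d → ℤ) :
    MeasurableSet (lowerHalf i₀ j k) :=
  (measurableSet_dyadicCell j k).inter (measurableSet_lt (by fun_prop) measurable_const)

theorem measurableSet_upperHalf (i₀ : Fin d) (j : ℕ) (k : Fin d → ℤ) :
    MeasurableSet (upperHalf i₀ j k) :=
  (measurableSet_dyadicCell j k).inter (measurableSet_le measurable_const (by fun_prop))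

theorem tensorWavelet_singleType (i₀ : Fin d) (j : ℕ) (k : Fin d → ℤ) :
    tensorWavelet (singleType i₀).1 j k =
      (lowerHalf i₀ j k).indicator 1 - (upperHalf i₀ j k).indicator 1 := by
  ext x
  by_cases hx : x ∈ dyadicCell j k
  · have hx' := mem_dyadicCell.1 hx
    have hprod : tensorWavelet (singleType i₀).1 j k x = haarH (2 ^ j * x i₀ - k i₀) := by
      rw [tensorWavelet, Finset.prod_eq_single i₀]
      · simp [singleType]
      · intro i _ hi
        simp only [singleType, hi, decide_false, Bool.false_eq_true, if_false]
        rw [haarP_apply, if_pos]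
        constructor <;> linarith [(hx' i).1, (hx' i).2]
      · simp
    have h := hx' i₀
    have hL : x ∈ lowerHalf i₀ j k ↔
        0 ≤ 2 ^ j * x i₀ - k i₀ ∧ 2 ^ j * x i₀ - k i₀ < 1 / 2 :=
      ⟨fun hl => ⟨by linarith, hl.2⟩, fun hl => ⟨hx, hl.2⟩⟩
    have hU : x ∈ upperHalf i₀ j k ↔
        1 / 2 ≤ 2 ^ j * x i₀ - k i₀ ∧ 2 ^ j * x i₀ - k i₀ < 1 :=
      ⟨fun hl => ⟨hl.2, by linarith⟩, fun hl => ⟨hx, hl.1⟩⟩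
    classical
    rw [hprod, haarH_apply, Pi.sub_apply, Set.indicator_apply, Set.indicator_apply]
    simp only [hL, hU, Pi.one_apply]
  · rw [tensorWavelet_eq_zero hx, Pi.sub_apply, Set.indicator_of_notMem fun h => hx h.1,
      Set.indicator_of_notMem fun h => hx h.1, sub_zero]

/-- If `B` is monotone in the direction `i₀` across a cell, then the wavelet integral is at least
the volume of any part `P` of `B` that leaves `B` under the half-cell shift. -/
theorem volumeReal_le_setIntegral_tensorWavelet {B P : Set (Fin d → ℝ)}
    (hP : MeasurableSet P) (i₀ : Fin d) (j : ℕ) (k : Fin d → ℤ)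
    (hPB : P ⊆ B ∩ lowerHalf i₀ j k)
    (hshift : ∀ y ∈ B ∩ upperHalf i₀ j k,
      y + Pi.single i₀ (-(((2 : ℝ) ^ j)⁻¹ / 2)) ∈ (B ∩ lowerHalf i₀ j k) \ P) :
    volume.real P ≤ ∫ x in B, tensorWavelet (singleType i₀).1 j k x := by
  have hcell : volume (dyadicCell j k) < ⊤ := by
    rw [volume_dyadicCell]; exact ENNReal.ofReal_lt_top
  have hfinL : volume (B ∩ lowerHalf i₀ j k) < ⊤ :=
    (measure_mono fun x hx => hx.2.1).trans_lt hcell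
  have hfinU : volume (B ∩ upperHalf i₀ j k) < ⊤ :=
    (measure_mono fun x hx => hx.2.1).trans_lt hcell
  have hint : ∫ x in B, tensorWavelet (singleType i₀).1 j k x =
      volume.real (B ∩ lowerHalf i₀ j k) - volume.real (B ∩ upperHalf i₀ j k) := by
    have hL := measurableSet_lowerHalf i₀ j k
    have hU := measurableSet_upperHalf i₀ j k
    rw [tensorWavelet_singleType, integral_sub', integral_indicator_one hL,
      integral_indicator_one hU, measureReal_restrict_apply hL, measureReal_restrict_apply hU,
      Set.inter_comm B, Set.inter_comm B]
    · rw [integrable_indicator_iff hL]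
      refine integrableOn_const ?_
      rw [Measure.restrict_apply hL, Set.inter_comm]
      exact hfinL.ne
    · rw [integrable_indicator_iff hU]
      refine integrableOn_const ?_
      rw [Measure.restrict_apply hU, Set.inter_comm]
      exact hfinU.ne
  have hle : volume.real (B ∩ upperHalf i₀ j k) ≤
      volume.real (B ∩ lowerHalf i₀ j k) - volume.real P := by
    rw [← measureReal_sdiff hPB hP hfinL.ne, measureReal_def,
      measureReal_def,
      ← measure_preimage_add_right volume (Pi.single i₀ (-(((2 : ℝ) ^ j)⁻¹ / 2)))
        ((B ∩ lowerHalf i₀ j k) \ P)]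
    refine ENNReal.toReal_mono ?_ (measure_mono hshift)
    rw [measure_preimage_add_right]
    exact ((measure_mono Set.sdiff_subset).trans_lt hfinL).ne
  rw [hint]
  linarith

/-- A level of a separable quadratic that crosses an edge of length `s` crosses, with a margin,
the middle half of one of three parallel edges. -/
theorem exists_crossing_with_margin {R p q s b T : ℝ} (hs : 0 < s)
    (hp : 9 / 10 * b ≤ p) (hp' : p + s ≤ b) (hq : 9 / 10 * b ≤ q) (hq' : q + s ≤ b)
    (h0 : R + p ^ 2 + (q + s / 2) ^ 2 < T) (h1 : T ≤ R + (p + s) ^ 2 + (q + s / 2) ^ 2) :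
    ∃ β : ℝ, 1 / 8 ≤ β ∧ β ≤ 7 / 8 ∧ R + (p + 1 / 4 * s) ^ 2 + (q + β * s) ^ 2 ≤ T - b * s / 16 ∧
      T + b * s / 16 ≤ R + (p + 3 / 4 * s) ^ 2 + (q + β * s) ^ 2 := by
  have e1 : 9 / 10 * (b * s) ≤ p * s := by nlinarith
  have e2 : p * s + s ^ 2 ≤ b * s := by nlinarith
  have e3 : 9 / 10 * (b * s) ≤ q * s := by nlinarith
  have e4 : q * s + s ^ 2 ≤ b * s := by nlinarith
  have e5 : 0 < s ^ 2 := by positivity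
  ring_nf at h0 h1 e1 e2 e3 e4 e5
  by_cases hA : R + (p + 1 / 4 * s) ^ 2 + (q + 1 / 2 * s) ^ 2 ≤ T - b * s / 16
  · by_cases hC : T + b * s / 16 ≤ R + (p + 3 / 4 * s) ^ 2 + (q + 1 / 2 * s) ^ 2
    · exact ⟨1 / 2, by norm_num, by norm_num, hA, hC⟩
    · refine ⟨7 / 8, by norm_num, by norm_num, ?_, ?_⟩ <;> ring_nf at hA hC ⊢ <;> linarith
  · refine ⟨1 / 8, by norm_num, by norm_num, ?_, ?_⟩ <;> ring_nf at hA ⊢ <;> linarith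

/-- Moving each coordinate by at most `s / 100` inside a box of radius `b` changes the squared
distance by at most `b * s / 16` in dimension at most three. -/
theorem sqDist_le_add_of_close (hd : d ≤ 3) {x₀ x y : Fin d → ℝ} {s b : ℝ} (hs : 0 ≤ s)
    (hb : 0 ≤ b) (hxy : ∀ i, |x i - y i| ≤ s / 100) (hx : ∀ i, |x i - x₀ i| ≤ b)
    (hy : ∀ i, |y i - x₀ i| ≤ b) :
    ∑ i, (x i - x₀ i) ^ 2 ≤ ∑ i, (y i - x₀ i) ^ 2 + 3 / 50 * (b * s) := by
  have h : ∀ i, (x i - x₀ i) ^ 2 ≤ (y i - x₀ i) ^ 2 + 1 / 50 * (b * s) := by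
    intro i
    have h1 : |(x i - x₀ i) + (y i - x₀ i)| ≤ 2 * b :=
      (abs_add_le _ _).trans (by linarith [hx i, hy i])
    have h2 : (x i - y i) * ((x i - x₀ i) + (y i - x₀ i)) ≤ s / 100 * (2 * b) := by
      refine (le_abs_self _).trans ?_
      rw [abs_mul]
      exact mul_le_mul (hxy i) h1 (abs_nonneg _) (by positivity)
    nlinarith
  refine (Finset.sum_le_sum fun i _ => h i).trans ?_
  rw [Finset.sum_add_distrib]
  simp only [Finset.sum_const, Finset.card_univ, Fintype.card_fin, nsmul_eq_mul]
  have : (d : ℝ) ≤ 3 := by exact_mod_cast hd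
  nlinarith [mul_nonneg hb hs]

/-- The point of the cell `k` of side `s` with relative coordinates `α` and `β` in the directions
`i₀` and `i₁`, and `1 / 2` in the other directions. -/
noncomputable def cellPoint (i₀ i₁ : Fin d) (s : ℝ) (k : Fin d → ℤ) (α β : ℝ) : Fin d → ℝ :=
  fun i => s * (k i + if i = i₀ then α else if i = i₁ then β else 1 / 2)

theorem exists_sqDist_cellPoint {i₀ i₁ : Fin d} (h : i₁ ≠ i₀) (x₀ : Fin d → ℝ) (s : ℝ)
    (k : Fin d → ℤ) : ∃ R : ℝ, ∀ α β : ℝ, ∑ i, (cellPoint i₀ i₁ s k α β i - x₀ i) ^ 2 =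
      R + (s * k i₀ - x₀ i₀ + α * s) ^ 2 + (s * k i₁ - x₀ i₁ + β * s) ^ 2 := by
  refine ⟨∑ i ∈ (Finset.univ.erase i₀).erase i₁, (s * (k i + 1 / 2) - x₀ i) ^ 2, fun α β => ?_⟩
  rw [← Finset.sum_erase_add _ _ (Finset.mem_univ i₀), ← Finset.sum_erase_add _ _
    (Finset.mem_erase.2 ⟨h, Finset.mem_univ i₁⟩)]
  have e : ∀ i ∈ (Finset.univ.erase i₀).erase i₁,
      (cellPoint i₀ i₁ s k α β i - x₀ i) ^ 2 = (s * (k i + 1 / 2) - x₀ i) ^ 2 := by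
    intro i hi
    simp only [Finset.mem_erase, Finset.mem_univ, and_true] at hi
    simp [cellPoint, hi.1, hi.2]
  rw [Finset.sum_congr rfl e]
  simp only [cellPoint, if_true, h, if_false]
  ring

theorem le_setIntegral_tensorWavelet_euclBall (hd : d ≤ 3) {i₀ i₁ : Fin d} (h : i₁ ≠ i₀)
    (x₀ : Fin d → ℝ) {r b : ℝ} (hb : 0 < b) (j : ℕ) (k : Fin d → ℤ)
    (hlo : ∀ i, 9 / 10 * b ≤ ((2 : ℝ) ^ j)⁻¹ * k i - x₀ i)
    (hhi : ∀ i, ((2 : ℝ) ^ j)⁻¹ * (k i + 1) - x₀ i ≤ b)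
    (hin : cellPoint i₀ i₁ ((2 : ℝ) ^ j)⁻¹ k 0 (1 / 2) ∈ euclBall x₀ r)
    (hout : cellPoint i₀ i₁ ((2 : ℝ) ^ j)⁻¹ k 1 (1 / 2) ∉ euclBall x₀ r) :
    (((2 : ℝ) ^ j)⁻¹ / 50) ^ d ≤
      ∫ x in euclBall x₀ r, tensorWavelet (singleType i₀).1 j k x := by
  set s : ℝ := ((2 : ℝ) ^ j)⁻¹ with hsdef
  have hs : 0 < s := by positivity
  have hs2 : (2 : ℝ) ^ j = s⁻¹ := by rw [hsdef, inv_inv]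
  obtain ⟨R, hR⟩ := exists_sqDist_cellPoint h x₀ s k
  simp only [euclBall, Set.mem_ofPred_eq, not_lt, hR] at hin hout
  obtain ⟨β, hβ1, hβ2, hlow, hupp⟩ := exists_crossing_with_margin (R := R) (T := r ^ 2) hs
    (hlo i₀) (by linarith [hhi i₀]) (hlo i₁) (by linarith [hhi i₁])
    (by ring_nf at hin ⊢; exact hin) (by ring_nf at hout ⊢; exact hout)
  set w := cellPoint i₀ i₁ s k (1 / 4) β with hw
  set w' := cellPoint i₀ i₁ s k (3 / 4) β with hw'
  have hrel : ∀ i, 1 / 8 ≤ (if i = i₀ then (1 / 4 : ℝ) else if i = i₁ then β else 1 / 2) ∧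
      (if i = i₀ then (1 / 4 : ℝ) else if i = i₁ then β else 1 / 2) ≤ 7 / 8 := by
    intro i
    split_ifs <;> constructor <;> linarith
  set P : Set (Fin d → ℝ) :=
    Set.univ.pi fun i => Set.Icc (w i - s / 100) (w i + s / 100) with hPdef
  have hvol : volume.real P = (s / 50) ^ d := by
    rw [measureReal_def, hPdef, volume_pi_pi]
    have e : ∀ i, w i + s / 100 - (w i - s / 100) = s / 50 := fun i => by ring
    simp only [Real.volume_Icc, e]
    rw [Finset.prod_const, ENNReal.toReal_pow, ENNReal.toReal_ofReal (by linarith),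
      Finset.card_univ, Fintype.card_fin]
  have hPk : ∀ x ∈ P, ∀ i, s * (k i + 11 / 100) ≤ x i ∧ x i ≤ s * (k i + 89 / 100) := by
    intro x hx i
    have h1 := hx i (Set.mem_univ i)
    have h2 := hrel i
    simp only [hw, cellPoint, Set.mem_Icc] at h1
    have h3 := mul_le_mul_of_nonneg_left h2.1 hs.le
    have h4 := mul_le_mul_of_nonneg_left h2.2 hs.le
    constructor <;> linarith [h1.1, h1.2]
  have hwP : w ∈ P := fun i _ => ⟨by linarith, by linarith⟩
  have hshiftcoord : ∀ x ∈ P, ∀ i, |x i - w i| ≤ s / 100 := by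
    intro x hx i
    have h1 := hx i (Set.mem_univ i)
    rw [abs_le]; constructor <;> linarith [h1.1, h1.2]
  have hx0 : ∀ x ∈ P, x i₀ ≤ s * (k i₀ + 26 / 100) := by
    intro x hx
    have h1 := hx i₀ (Set.mem_univ i₀)
    simp only [hw, cellPoint, Set.mem_Icc, if_true] at h1
    linarith [h1.2]
  have habs : ∀ (x : Fin d → ℝ) i, s * k i ≤ x i → x i ≤ s * (k i + 1) → |x i - x₀ i| ≤ b := by
    intro x i h1 h2
    rw [abs_le]; constructor <;> linarith [hlo i, hhi i]
  have hPball : ∀ x ∈ P, x ∈ euclBall x₀ r := by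
    intro x hx
    have := sqDist_le_add_of_close (x₀ := x₀) (x := x) (y := w) hd hs.le hb.le
      (hshiftcoord x hx)
      (fun i => habs x i (by linarith [(hPk x hx i).1]) (by linarith [(hPk x hx i).2]))
      (fun i => habs w i (by linarith [(hPk w hwP i).1]) (by linarith [(hPk w hwP i).2]))
    have e := hR (1 / 4) β
    simp only [euclBall, Set.mem_ofPred_eq]
    rw [← hw] at e
    have : 0 < b * s := by positivity
    linarith
  have hPshift : ∀ x ∈ P, x + Pi.single i₀ (s / 2) ∉ euclBall x₀ r := by
    intro x hx
    have hw'i : ∀ i, w' i = w i + (Pi.single i₀ (s / 2) : Fin d → ℝ) i := by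
      intro i
      by_cases hi : i = i₀
      · subst hi; simp only [hw, hw', cellPoint, if_true, Pi.single_eq_same]; ring
      · simp [hw, hw', cellPoint, hi]
    have hcoord : ∀ y ∈ P, ∀ i, s * k i ≤ (y + Pi.single i₀ (s / 2) : Fin d → ℝ) i ∧
        (y + Pi.single i₀ (s / 2) : Fin d → ℝ) i ≤ s * (k i + 1) := by
      intro y hy i
      have h1 := hPk y hy i
      by_cases hi : i = i₀
      · subst hi
        rw [Pi.add_apply, Pi.single_eq_same]
        have := hx0 y hy
        constructor <;> linarith
      · rw [Pi.add_apply, Pi.single_eq_of_ne hi, add_zero]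
        constructor <;> linarith
    have := sqDist_le_add_of_close (x₀ := x₀) (x := w') (y := x + Pi.single i₀ (s / 2)) hd
      hs.le hb.le
      (fun i => by
        rw [hw'i, Pi.add_apply, add_sub_add_right_eq_sub, abs_sub_comm]
        exact hshiftcoord x hx i)
      (fun i => by
        have h1 := hcoord w hwP i
        rw [Pi.add_apply, ← hw'i] at h1
        exact habs w' i h1.1 h1.2)
      (fun i => habs _ i (hcoord x hx i).1 (hcoord x hx i).2)
    have e := hR (3 / 4) β
    rw [← hw'] at e
    simp only [euclBall, Set.mem_ofPred_eq, not_lt]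
    have : 0 < b * s := by positivity
    linarith
  rw [← hvol]
  refine volumeReal_le_setIntegral_tensorWavelet
    (MeasurableSet.univ_pi fun _ => measurableSet_Icc) i₀ j k ?_ ?_
  · intro x hx
    refine ⟨hPball x hx, mem_dyadicCell.2 fun i => ?_, ?_⟩
    · have h1 := hPk x hx i
      have h2 : x i = s * (s⁻¹ * x i) := by field_simp
      rw [hs2]
      rw [h2, mul_le_mul_iff_right₀ hs, mul_le_mul_iff_right₀ hs] at h1
      constructor <;> linarith [h1.1, h1.2]
    · have h1 := hx0 x hx
      have h2 : x i₀ = s * (s⁻¹ * x i₀) := by field_simp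
      rw [h2, mul_le_mul_iff_right₀ hs] at h1
      simp only [Set.mem_ofPred_eq]
      rw [hs2]
      linarith
  · rintro y ⟨hyB, hyQ, hyU⟩
    have hy := mem_dyadicCell.1 hyQ
    simp only [Set.mem_ofPred_eq] at hyU
    rw [hs2] at hy hyU
    have hsh : (2 : ℝ) ^ j * (y + Pi.single i₀ (-(((2 : ℝ) ^ j)⁻¹ / 2)) : Fin d → ℝ) i₀ =
        s⁻¹ * y i₀ - 1 / 2 := by
      rw [Pi.add_apply, Pi.single_eq_same, ← hsdef, hs2]
      field_simp
      ring
    refine ⟨⟨?_, mem_dyadicCell.2 fun i => ?_, ?_⟩, fun hP => hPshift _ hP ?_⟩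
    · simp only [euclBall, Set.mem_ofPred_eq] at hyB ⊢
      refine lt_of_le_of_lt (Finset.sum_le_sum fun i _ => ?_) hyB
      by_cases hi : i = i₀
      · subst hi
        rw [Pi.add_apply, Pi.single_eq_same]
        have h2 : s * (k i + 1 / 2) ≤ y i := by
          rw [show y i = s * (s⁻¹ * y i) by field_simp]
          exact mul_le_mul_of_nonneg_left (by linarith) hs.le
        have h3 := hlo i
        nlinarith
      · rw [Pi.add_apply, Pi.single_eq_of_ne hi, add_zero]
    · by_cases hi : i = i₀
      · subst hi
        rw [hsh]
        constructor <;> linarith [(hy i).2]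
      · rw [Pi.add_apply, Pi.single_eq_of_ne hi, add_zero, hs2]
        exact hy i
    · simp only [Set.mem_ofPred_eq]
      rw [hsh]
      linarith [(hy i₀).2]
    · rwa [add_assoc, ← Pi.single_add, neg_add_cancel, Pi.single_zero, add_zero]

/-- Over every base cell near the diagonal direction there is a cell crossed by the sphere. -/
theorem exists_update_crossing (hd : d = 2 ∨ d = 3) {i₀ i₁ : Fin d} (h : i₁ ≠ i₀)
    (x₀ : Fin d → ℝ) {r ρ s : ℝ} (hρ : 0 < ρ) (hr : d * ρ ^ 2 = r ^ 2) (hs : 0 < s)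
    (hsρ : s ≤ ρ / 100) (k : Fin d → ℤ)
    (hlo : ∀ i, i ≠ i₀ → 99 / 100 * ρ ≤ s * k i - x₀ i)
    (hhi : ∀ i, i ≠ i₀ → s * (k i + 1) - x₀ i ≤ 101 / 100 * ρ) :
    ∃ n : ℤ, (∀ i, 9 / 10 * (26 / 25 * ρ) ≤ s * Function.update k i₀ n i - x₀ i) ∧
      (∀ i, s * (Function.update k i₀ n i + 1) - x₀ i ≤ 26 / 25 * ρ) ∧
      cellPoint i₀ i₁ s (Function.update k i₀ n) 0 (1 / 2) ∈ euclBall x₀ r ∧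
      cellPoint i₀ i₁ s (Function.update k i₀ n) 1 (1 / 2) ∉ euclBall x₀ r := by
  set R : ℝ := ∑ i ∈ Finset.univ.erase i₀, (s * (k i + 1 / 2) - x₀ i) ^ 2 with hR
  have hsum : ∀ (n : ℤ) (α : ℝ),
      ∑ i, (cellPoint i₀ i₁ s (Function.update k i₀ n) α (1 / 2) i - x₀ i) ^ 2 =
        R + (s * (n + α) - x₀ i₀) ^ 2 := by
    intro n α
    rw [← Finset.sum_erase_add _ _ (Finset.mem_univ i₀), hR]
    congr 1
    · refine Finset.sum_congr rfl fun i hi => ?_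
      simp [cellPoint, Finset.ne_of_mem_erase hi]
    · simp [cellPoint]
  have hd1 : 1 ≤ d := by omega
  have hcard : ((Finset.univ.erase i₀ : Finset (Fin d)).card : ℝ) = d - 1 := by
    rw [Finset.card_erase_of_mem (Finset.mem_univ i₀), Finset.card_univ, Fintype.card_fin]
    push_cast [hd1]
    ring
  have hRlo : (d - 1 : ℝ) * (99 / 100 * ρ) ^ 2 ≤ R := by
    rw [← hcard, ← nsmul_eq_mul]
    refine Finset.card_nsmul_le_sum _ _ _ fun i hi => ?_
    have h1 := hlo i (Finset.ne_of_mem_erase hi)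
    exact pow_le_pow_left₀ (by positivity) (by linarith) 2
  have hRhi : R ≤ (d - 1 : ℝ) * (101 / 100 * ρ) ^ 2 := by
    rw [← hcard, ← nsmul_eq_mul]
    refine Finset.sum_le_card_nsmul _ _ _ fun i hi => ?_
    have h1 := hlo i (Finset.ne_of_mem_erase hi)
    have h2 := hhi i (Finset.ne_of_mem_erase hi)
    exact pow_le_pow_left₀ (by linarith) (by linarith) 2
  have hT : (97 / 100 * ρ) ^ 2 ≤ r ^ 2 - R ∧ r ^ 2 - R ≤ (102 / 100 * ρ) ^ 2 := by
    have : 0 < ρ ^ 2 := by positivity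
    rcases hd with rfl | rfl <;> push_cast at hr hRlo hRhi <;> constructor <;> nlinarith
  obtain ⟨τ, hτ0, hτ⟩ : ∃ τ : ℝ, 0 ≤ τ ∧ τ ^ 2 = r ^ 2 - R :=
    ⟨√(r ^ 2 - R), Real.sqrt_nonneg _, Real.sq_sqrt (le_trans (by positivity) hT.1)⟩
  rw [← hτ] at hT
  have hτlo : 97 / 100 * ρ ≤ τ := le_of_sq_le_sq hT.1 hτ0
  have hτhi : τ ≤ 102 / 100 * ρ := le_of_sq_le_sq hT.2 (by positivity)
  set m : ℤ := ⌈(τ + x₀ i₀) / s⌉ with hm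
  have hm1 : τ ≤ s * m - x₀ i₀ := by
    have := Int.le_ceil ((τ + x₀ i₀) / s)
    rw [div_le_iff₀ hs] at this
    linarith
  have hm2 : s * (m - 1) - x₀ i₀ < τ := by
    have := Int.ceil_lt_add_one ((τ + x₀ i₀) / s)
    rw [← sub_lt_iff_lt_add, lt_div_iff₀ hs] at this
    linarith
  refine ⟨m - 1, fun i => ?_, fun i => ?_, ?_, ?_⟩
  · by_cases hi : i = i₀
    · subst hi
      rw [Function.update_self]
      push_cast
      linarith
    · rw [Function.update_of_ne hi]
      linarith [hlo i hi]
  · by_cases hi : i = i₀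
    · subst hi
      rw [Function.update_self]
      push_cast
      linarith
    · rw [Function.update_of_ne hi]
      linarith [hhi i hi]
  · simp only [euclBall, Set.mem_ofPred_eq]
    rw [hsum]
    push_cast
    rw [add_zero]
    have : (s * (m - 1) - x₀ i₀) ^ 2 < τ ^ 2 :=
      pow_lt_pow_left₀ hm2 (by linarith) two_ne_zero
    linarith
  · simp only [euclBall, Set.mem_ofPred_eq, not_lt]
    rw [hsum]
    push_cast
    rw [sub_add_cancel]
    have : τ ^ 2 ≤ (s * m - x₀ i₀) ^ 2 := pow_le_pow_left₀ hτ0 hm1 2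
    linarith

theorem exists_many_large_coeff (hd : d = 2 ∨ d = 3) {r : ℝ} (hr : 0 < r) (x₀ : Fin d → ℝ) :
    ∃ c : ℝ, 0 < c ∧ ∃ j₀ : ℕ, ∀ j, j₀ ≤ j →
      ∃ A : Finset (Option ({g : Fin d → Bool // g ≠ fun _ => false} × ℕ × (Fin d → ℤ))),
        c * (2 ^ j) ^ (d - 1) ≤ A.card ∧
        ∀ lam ∈ A, c / (2 ^ j) ^ d ≤ haarTensorCoeff d (euclBall x₀ r) lam ^ 2 := by
  classical
  set i₀ : Fin d := ⟨0, by omega⟩ with hi₀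
  set i₁ : Fin d := ⟨1, by omega⟩ with hi₁
  have h01 : i₁ ≠ i₀ := by simp [hi₀, hi₁]
  have hd0 : (0 : ℝ) < d := by rcases hd with rfl | rfl <;> norm_num
  obtain ⟨ρ, hρ, hρr⟩ : ∃ ρ : ℝ, 0 < ρ ∧ d * ρ ^ 2 = r ^ 2 := by
    refine ⟨√(r ^ 2 / d), Real.sqrt_pos.2 (by positivity), ?_⟩
    rw [Real.sq_sqrt (by positivity)]
    field_simp
  obtain ⟨j₀, hj₀⟩ := pow_unbounded_of_one_lt (200 / ρ) (one_lt_two (α := ℝ))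
  refine ⟨min ((ρ / 200) ^ (d - 1)) ((1 / 50 ^ d) ^ 2), by positivity, j₀, fun j hj => ?_⟩
  have hpow : 200 / ρ < (2 : ℝ) ^ j :=
    hj₀.trans_le (pow_le_pow_right₀ one_le_two hj)
  rw [div_lt_iff₀ hρ] at hpow
  set s : ℝ := ((2 : ℝ) ^ j)⁻¹ with hs
  have hs0 : 0 < s := by positivity
  have hs2 : (2 : ℝ) ^ j * s = 1 := mul_inv_cancel₀ (by positivity)
  have hsρ : s ≤ ρ / 200 := by nlinarith
  set M : ℕ := ⌊ρ / 100 * 2 ^ j⌋₊ with hM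
  have hM1 : (M : ℝ) ≤ ρ / 100 * 2 ^ j := Nat.floor_le (by positivity)
  have hM2 : ρ / 100 * 2 ^ j < M + 1 := Nat.lt_floor_add_one _
  have hsM : s * M ≤ ρ / 100 := by nlinarith
  set base : ({i : Fin d // i ≠ i₀} → Fin M) → Fin d → ℤ := fun n i =>
    if hi : i ≠ i₀ then ⌈2 ^ j * (x₀ i + 99 / 100 * ρ)⌉ + (n ⟨i, hi⟩ : ℕ) else 0 with hbase
  have hex : ∀ n, ∃ m : ℤ, (s / 50) ^ d ≤ ∫ x in euclBall x₀ r,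
      tensorWavelet (singleType i₀).1 j (Function.update (base n) i₀ m) x := by
    intro n
    have hlow : ∀ i ≠ i₀, x₀ i + 99 / 100 * ρ ≤ s * (base n i : ℝ) := by
      intro i hi
      have hc := Int.le_ceil (2 ^ j * (x₀ i + 99 / 100 * ρ))
      simp only [hbase, hi, ne_eq, not_false_eq_true, dif_pos]
      push_cast
      have hn : (0 : ℝ) ≤ ((n ⟨i, hi⟩ : ℕ) : ℝ) := Nat.cast_nonneg _
      have := mul_le_mul_of_nonneg_left (add_le_add hc hn) hs0.le
      have e : s * (2 ^ j * (x₀ i + 99 / 100 * ρ) + 0) = x₀ i + 99 / 100 * ρ := by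
        linear_combination (x₀ i + 99 / 100 * ρ) * hs2
      linarith
    have hupp : ∀ i ≠ i₀, s * (base n i : ℝ) ≤ x₀ i + 99 / 100 * ρ + s + s * M := by
      intro i hi
      have hc := (Int.ceil_lt_add_one (2 ^ j * (x₀ i + 99 / 100 * ρ))).le
      simp only [hbase, hi, ne_eq, not_false_eq_true, dif_pos]
      push_cast
      have hn : ((n ⟨i, hi⟩ : ℕ) : ℝ) ≤ M := by exact_mod_cast (n ⟨i, hi⟩).2.le
      have := mul_le_mul_of_nonneg_left (add_le_add hc hn) hs0.le
      have e : s * (2 ^ j * (x₀ i + 99 / 100 * ρ) + 1 + M) = x₀ i + 99 / 100 * ρ + s + s * M := by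
        linear_combination (x₀ i + 99 / 100 * ρ) * hs2
      linarith
    obtain ⟨m, h1, h2, h3, h4⟩ := exists_update_crossing hd h01 x₀ hρ hρr hs0
      (by linarith) (base n) (fun i hi => by linarith [hlow i hi])
      (fun i hi => by linarith [hupp i hi])
    exact ⟨m, le_setIntegral_tensorWavelet_euclBall (by omega) h01 x₀ (by positivity) j _
      h1 h2 h3 h4⟩
  choose m hm using hex
  set idx : ({i : Fin d // i ≠ i₀} → Fin M) →
      Option ({g : Fin d → Bool // g ≠ fun _ => false} × ℕ × (Fin d → ℤ)) := fun n =>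
    some (singleType i₀, j, Function.update (base n) i₀ (m n)) with hidx
  have hinj : Function.Injective idx := by
    intro n n' hn
    simp only [hidx, Option.some.injEq, Prod.mk.injEq, true_and] at hn
    funext i
    have := congrFun hn i.1
    rw [Function.update_of_ne i.2, Function.update_of_ne i.2] at this
    simp only [hbase, i.2, ne_eq, not_false_eq_true, dif_pos] at this
    exact Fin.ext (by exact_mod_cast add_left_cancel this)
  refine ⟨Finset.univ.image idx, ?_, fun lam hlam => ?_⟩
  · rw [Finset.card_image_of_injective _ hinj, Finset.card_univ, Fintype.card_fun,
      Fintype.card_fin, Fintype.card_subtype_compl, Fintype.card_fin, Fintype.card_subtype_eq]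
    push_cast
    calc _ ≤ (ρ / 200) ^ (d - 1) * ((2 : ℝ) ^ j) ^ (d - 1) := by
          gcongr
          exact min_le_left _ _
      _ = (ρ / 200 * 2 ^ j) ^ (d - 1) := by rw [mul_pow]
      _ ≤ (M : ℝ) ^ (d - 1) := by
          gcongr
          linarith
  · obtain ⟨n, -, rfl⟩ := Finset.mem_image.1 hlam
    rw [hidx, haarTensorCoeff_sq]
    calc _ ≤ (1 / 50 ^ d) ^ 2 / ((2 : ℝ) ^ j) ^ d := by
          gcongr
          exact min_le_right _ _
      _ = ((2 : ℝ) ^ j) ^ d * ((s / 50) ^ d) ^ 2 := by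
          rw [hs, div_pow _ (50 : ℝ) d, inv_pow]
          field_simp
      _ ≤ _ := by
          gcongr
          exact hm n

/-- The index set of the wavelets of scale `j` living on the cells in `F`. -/
def levelIndices (j : ℕ) (F : Finset (Fin d → ℤ)) :
    Finset (Option ({g : Fin d → Bool // g ≠ fun _ => false} × ℕ × (Fin d → ℤ))) :=
  (Finset.univ ×ˢ F).map
    ⟨fun p => some (p.1, j, p.2), fun p q h => by
      simp only [Option.some.injEq, Prod.mk.injEq, true_and] at h
      exact Prod.ext h.1 h.2⟩

theorem haarTensorCoeff_sq_le (B : Set (Fin d → ℝ))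
    (g : {g : Fin d → Bool // g ≠ fun _ => false}) (j : ℕ) (k : Fin d → ℤ) :
    haarTensorCoeff d B (some (g, j, k)) ^ 2 ≤ ((2 : ℝ) ^ j)⁻¹ ^ d := by
  rw [haarTensorCoeff_sq, ← sq_abs]
  calc _ ≤ ((2 : ℝ) ^ j) ^ d * (((2 : ℝ) ^ j)⁻¹ ^ d) ^ 2 := by
        gcongr
        exact abs_setIntegral_tensorWavelet_le B g.1 j k
    _ = ((2 : ℝ) ^ j)⁻¹ ^ d := by
        rw [inv_pow]
        field_simp

theorem exists_sparse_levels (hd : 2 ≤ d) {r : ℝ} (hr : 0 < r) (x₀ : Fin d → ℝ)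
    (hB : euclBall x₀ r ⊆ Set.univ.pi fun _ => Set.Icc (0 : ℝ) 1) :
    ∃ C : ℝ, 0 < C ∧
      ∃ U : ℕ → Finset (Option ({g : Fin d → Bool // g ≠ fun _ => false} × ℕ × (Fin d → ℤ))),
        (∀ J, ((U J).card : ℝ) ≤ C * (2 ^ J) ^ (d - 1)) ∧
        ∀ J u, Disjoint u (U J) →
          ∑ lam ∈ u, haarTensorCoeff d (euclBall x₀ r) lam ^ 2 ≤ C / 2 ^ J := by
  classical
  obtain ⟨C, hC, hcard⟩ := exists_card_boundaryCells_le hr x₀ hB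
  set F : ℕ → Finset (Fin d → ℤ) := fun j => (boundaryCells_finite hB j).toFinset with hF
  set G : ℝ := (Fintype.card {g : Fin d → Bool // g ≠ fun _ => false} : ℝ) with hG
  have hG0 : 0 ≤ G := Nat.cast_nonneg _
  have hlev : ∀ j, ((levelIndices j (F j)).card : ℝ) = G * (F j).card := fun j => by
    rw [levelIndices, Finset.card_map, Finset.card_product, Finset.card_univ]
    push_cast
    rfl
  have hFj : ∀ j, (F j).card * ((2 : ℝ) ^ j)⁻¹ ^ d ≤ C * ((2 : ℝ) ^ j)⁻¹ := fun j =>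
    hcard j (F j) (by simp [hF])
  have hFcard : ∀ j, ((F j).card : ℝ) ≤ C * (2 ^ j) ^ (d - 1) := fun j => by
    have h := hFj j
    obtain ⟨e, rfl⟩ : ∃ e, d = e + 1 := ⟨d - 1, by omega⟩
    rw [pow_succ, ← mul_assoc, mul_le_mul_iff_left₀ (by positivity), inv_pow,
      ← div_eq_mul_inv, div_le_iff₀ (by positivity)] at h
    simpa using h
  refine ⟨1 + 2 * G * C, by positivity,
    fun J => insert none ((Finset.range J).biUnion fun j => levelIndices j (F j)),
    fun J => ?_, fun J u hu => ?_⟩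
  · have h2 : ∑ j ∈ Finset.range J, ((2 : ℝ) ^ j) ^ (d - 1) ≤ (2 ^ J) ^ (d - 1) := by
      induction J with
      | zero => simp
      | succ J ih =>
        rw [Finset.sum_range_succ, pow_succ, mul_pow]
        have : (2 : ℝ) ≤ 2 ^ (d - 1) := le_self_pow₀ one_le_two (by omega)
        nlinarith [pow_pos (pow_pos (two_pos (α := ℝ)) J) (d - 1)]
    have h1 : (1 : ℝ) ≤ (2 ^ J) ^ (d - 1) := one_le_pow₀ (one_le_pow₀ one_le_two)
    calc _ ≤ ((∑ j ∈ Finset.range J, (levelIndices j (F j)).card + 1 : ℕ) : ℝ) := by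
          exact_mod_cast (Finset.card_insert_le _ _).trans
            (Nat.add_le_add_right Finset.card_biUnion_le 1)
      _ = ∑ j ∈ Finset.range J, G * (F j).card + 1 := by push_cast [hlev]; rfl
      _ ≤ ∑ j ∈ Finset.range J, G * (C * (2 ^ j) ^ (d - 1)) + 1 := by
          gcongr with j _
          exact hFcard j
      _ = G * C * ∑ j ∈ Finset.range J, ((2 : ℝ) ^ j) ^ (d - 1) + 1 := by
          rw [Finset.mul_sum]
          simp only [mul_assoc]
      _ ≤ G * C * (2 ^ J) ^ (d - 1) + (2 ^ J) ^ (d - 1) := by gcongr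
      _ ≤ _ := by nlinarith [mul_nonneg (mul_nonneg hG0 hC) (zero_le_one.trans h1)]
  · obtain ⟨L, hL⟩ : ∃ L : ℕ, ∀ g j k, some (g, j, k) ∈ u → j < L := by
      refine ⟨u.sup (fun lam => lam.elim 0 fun p => p.2.1) + 1, fun g j k h => ?_⟩
      exact Nat.lt_succ_of_le (Finset.le_sup (f := fun lam : Option ({g : Fin d → Bool //
        g ≠ fun _ => false} × ℕ × (Fin d → ℤ)) => lam.elim 0 fun p => p.2.1) h)
    have hlevsum : ∀ j, ∑ lam ∈ levelIndices j (F j),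
        haarTensorCoeff d (euclBall x₀ r) lam ^ 2 ≤ G * C * (1 / 2) ^ j := by
      intro j
      calc _ ≤ (levelIndices j (F j)).card • ((2 : ℝ) ^ j)⁻¹ ^ d := by
            refine Finset.sum_le_card_nsmul _ _ _ fun lam hlam => ?_
            obtain ⟨p, -, rfl⟩ := Finset.mem_map.1 hlam
            exact haarTensorCoeff_sq_le _ _ _ _
        _ = G * ((F j).card * ((2 : ℝ) ^ j)⁻¹ ^ d) := by rw [nsmul_eq_mul, hlev, mul_assoc]
        _ ≤ G * (C * ((2 : ℝ) ^ j)⁻¹) := by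
            have := hFj j
            gcongr
        _ = _ := by rw [one_div, inv_pow, mul_assoc]
    have hsub : ∑ lam ∈ u, haarTensorCoeff d (euclBall x₀ r) lam ^ 2 ≤
        ∑ lam ∈ (Finset.Ico J L).biUnion fun j => levelIndices j (F j),
          haarTensorCoeff d (euclBall x₀ r) lam ^ 2 := by
      rw [← Finset.sum_filter_ne_zero]
      refine Finset.sum_le_sum_of_subset_of_nonneg (fun lam hlam => ?_) fun _ _ _ => sq_nonneg _
      obtain ⟨hlam, hne⟩ := Finset.mem_filter.1 hlam
      have hnU := Finset.disjoint_left.1 hu hlam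
      rcases lam with _ | ⟨g, j, k⟩
      · exact absurd (Finset.mem_insert_self _ _) hnU
      · have hk : k ∈ F j := by
          rw [hF, Set.Finite.mem_toFinset]
          by_contra hk
          refine hne ?_
          rw [haarTensorCoeff_sq, setIntegral_tensorWavelet_eq_zero g.2]
          · simp
          · by_contra hcon
            push Not at hcon
            exact hk hcon
        have hmem : some (g, j, k) ∈ levelIndices j (F j) :=
          Finset.mem_map.2 ⟨(g, k), by simp [hk], rfl⟩
        refine Finset.mem_biUnion.2 ⟨j, Finset.mem_Ico.2 ⟨?_, hL g j k hlam⟩, hmem⟩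
        by_contra hlt
        exact hnU (Finset.mem_insert_of_mem
          (Finset.mem_biUnion.2 ⟨j, Finset.mem_range.2 (by omega), hmem⟩))
    have hgeom : ∑ j ∈ Finset.Ico J L, ((1 : ℝ) / 2) ^ j ≤ 2 * (1 / 2) ^ J := by
      have := geom_sum_Ico_le_of_lt_one (m := J) (n := L) (x := (1 / 2 : ℝ)) (by norm_num)
        (by norm_num)
      linarith [show ((1 : ℝ) / 2) ^ J / (1 - 1 / 2) = 2 * (1 / 2) ^ J by ring]
    refine hsub.trans ?_
    rw [Finset.sum_biUnion]
    · calc _ ≤ ∑ j ∈ Finset.Ico J L, G * C * (1 / 2) ^ j :=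
            Finset.sum_le_sum fun j _ => hlevsum j
        _ = G * C * ∑ j ∈ Finset.Ico J L, ((1 : ℝ) / 2) ^ j := by rw [Finset.mul_sum]
        _ ≤ G * C * (2 * (1 / 2) ^ J) := by gcongr
        _ = 2 * G * C / 2 ^ J := by rw [one_div, inv_pow]; ring
        _ ≤ _ := by gcongr; linarith
    · intro j _ j' _ hjj
      rw [Function.onFun, Finset.disjoint_left]
      intro lam h1 h2
      obtain ⟨p, -, rfl⟩ := Finset.mem_map.1 h1
      obtain ⟨q, -, hq⟩ := Finset.mem_map.1 h2
      exact hjj (congrArg (fun p => p.2.1) (Option.some.inj hq)).symm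

end

/-- Best `N`-term Haar wavelet approximation of the indicator of a ball in `[0,1]^d`,
`d = 2, 3`, has squared error comparable to `N^{-1/(d-1)}`. -/
theorem stmt_11 (d : ℕ) (hd : d = 2 ∨ d = 3) (r : ℝ) (hr : 0 < r) (x₀ : Fin d → ℝ)
    (hB : {x : Fin d → ℝ | ∑ i, (x i - x₀ i) ^ 2 < r ^ 2} ⊆
      Set.univ.pi fun _ => Set.Icc (0 : ℝ) 1)
    (bestErr : ℕ → ℝ)
    (hbest : ∀ N : ℕ, bestErr N = sInf {t : ℝ |
      ∃ S : Finset (Option ({g : Fin d → Bool // g ≠ fun _ => false} × ℕ × (Fin d → ℤ))),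
        S.card = N ∧ t = ∑' lam : {lam // lam ∉ S},
          haarTensorCoeff d {x : Fin d → ℝ | ∑ i, (x i - x₀ i) ^ 2 < r ^ 2} lam.1 ^ 2}) :
    ∃ c C : ℝ, 0 < c ∧ 0 < C ∧ ∃ N₀ : ℕ, ∀ N : ℕ, N₀ ≤ N →
      c * (N : ℝ) ^ (-(1 : ℝ) / ((d : ℝ) - 1)) ≤ bestErr N ∧
      bestErr N ≤ C * (N : ℝ) ^ (-(1 : ℝ) / ((d : ℝ) - 1)) := by
  have hd2 : 2 ≤ d := by omega
  have hi₀ : 0 < d := by omega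
  have : Nonempty (Fin d) := ⟨⟨0, hi₀⟩⟩
  have : Nonempty {g : Fin d → Bool // g ≠ fun _ => false} := ⟨singleType ⟨0, hi₀⟩⟩
  obtain ⟨C, hC, U, hU, htail⟩ := exists_sparse_levels hd2 hr x₀ hB
  obtain ⟨c, hc, j₀, hA⟩ := exists_many_large_coeff hd hr x₀
  have hde : d - 1 + 1 = d := by omega
  have hcast : (d : ℝ) - 1 = ((d - 1 : ℕ) : ℝ) := by
    rw [Nat.cast_sub (by omega), Nat.cast_one]
  rw [hcast]
  exact exists_rate_of_sparse_levels (fun lam => haarTensorCoeff d (euclBall x₀ r) lam ^ 2)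
    (fun _ => sq_nonneg _) (d - 1) (by omega) hC hc U hU htail j₀
    (by rw [hde]; exact hA) bestErr hbest
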